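/- arXiv:2501.02413 — 2 statements merged into one kernel-verified Lean document; each statement's English description precedes it below -/
import Mathlib

section
/- For every reachable tree automaton A over a signature Σ, the congruence closure CC(A) exists and is unique up to isomorphism: there is an E-graph CC(A) with A ⊑ CC(A) such that for every E-graph G' with A ⊑ G' one has CC(A) ⊑ G'. -/
set_option autoImplicit false

/-! ## Terms over a signature -/

inductive Tm (F : Type) (ar : F → ℕ) (V : Type) : Type where
  | var : V → Tm F ar V
  | node : (f : F) → (Fin (ar f) → Tm F ar V) → Tm F ar V

namespace Tm

variable {F : Type} {ar : F → ℕ} {V W : Type}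

/-- Apply a renaming of variables/states. -/
def map (σ : V → W) : Tm F ar V → Tm F ar W
  | .var v => .var (σ v)
  | .node f ts => .node f fun i => (ts i).map σ

/-- Apply a substitution. -/
def subst (σ : V → Tm F ar W) : Tm F ar V → Tm F ar W
  | .var v => σ v
  | .node f ts => .node f fun i => (ts i).subst σ

/-- The set of variables occurring in a pattern. -/
def vars : Tm F ar V → Set V
  | .var v => {v}
  | .node _ ts => ⋃ i, (ts i).vars

end Tm

/-- Ground terms: terms with no variables. -/
abbrev GTm (F : Type) (ar : F → ℕ) : Type := Tm F ar Empty

/-- A ground term viewed as a term over `Σ ∪ V`. -/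
def GTm.embed {F : Type} {ar : F → ℕ} {V : Type} (t : GTm F ar) : Tm F ar V :=
  Tm.map (fun e => e.elim) t

/-- The (reflexive) subterm relation. -/
inductive Subterm {F : Type} {ar : F → ℕ} {V : Type} : Tm F ar V → Tm F ar V → Prop where
  | refl (t : Tm F ar V) : Subterm t t
  | node {u : Tm F ar V} {f : F} {ts : Fin (ar f) → Tm F ar V} (i : Fin (ar f)) :
      Subterm u (ts i) → Subterm u (.node f ts)

theorem Subterm.trans' {F : Type} {ar : F → ℕ} {V : Type} {a b c : Tm F ar V}
    (h1 : Subterm a b) (h2 : Subterm b c) : Subterm a c := by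
  induction h2 with
  | refl => exact h1
  | node i _ ih => exact Subterm.node i ih

theorem Subterm.child {F : Type} {ar : F → ℕ} {V : Type} {f : F}
    {ts : Fin (ar f) → Tm F ar V} {c : Tm F ar V} (i : Fin (ar f))
    (h : Subterm (.node f ts) c) : Subterm (ts i) c :=
  Subterm.trans' (Subterm.node i (Subterm.refl _)) h

/-! ## Tree automata and E-graphs -/

/-- A (bottom-up, possibly infinite) tree automaton: a set of states together with
transitions `f(q₁,…,qₖ) → q`. -/
structure Automaton (F : Type) (ar : F → ℕ) : Type 1 where
  Q : Type
  trans : (f : F) → Set ((Fin (ar f) → Q) × Q)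

/-- `Accepts A t q` formalizes `t →*_A q`: the term `t ∈ T(Σ ∪ Q)` rewrites to the state `q`. -/
inductive Accepts {F : Type} {ar : F → ℕ} (A : Automaton F ar) : Tm F ar A.Q → A.Q → Prop where
  | var (q : A.Q) : Accepts A (.var q) q
  | node {f : F} {ts : Fin (ar f) → Tm F ar A.Q} {qs : Fin (ar f) → A.Q} {q : A.Q} :
      (∀ i, Accepts A (ts i) (qs i)) → (qs, q) ∈ A.trans f → Accepts A (.node f ts) q

/-- A ground term `t ∈ T(Σ)` is accepted by the state `q`, i.e. `t →*_A q`. -/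
def Automaton.AcceptsG {F : Type} {ar : F → ℕ} (A : Automaton F ar) (t : GTm F ar) (q : A.Q) : Prop :=
  Accepts A (GTm.embed t) q

/-- Deterministic: every ground term is accepted by at most one state. -/
def Automaton.Deterministic {F : Type} {ar : F → ℕ} (A : Automaton F ar) : Prop :=
  ∀ (t : GTm F ar) (q1 q2 : A.Q), A.AcceptsG t q1 → A.AcceptsG t q2 → q1 = q2

/-- Reachable: every state accepts some ground term. -/
def Automaton.ReachableA {F : Type} {ar : F → ℕ} (A : Automaton F ar) : Prop :=
  ∀ q : A.Q, ∃ t : GTm F ar, A.AcceptsG t q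

/-- An E-graph is a deterministic and reachable tree automaton. -/
structure EGraph (F : Type) (ar : F → ℕ) extends Automaton F ar where
  det : toAutomaton.Deterministic
  reach : toAutomaton.ReachableA

/-- A homomorphism of tree automata: maps states to states, preserving all transitions. -/
structure AHom {F : Type} {ar : F → ℕ} (A B : Automaton F ar) : Type where
  toFun : A.Q → B.Q
  map_trans : ∀ (f : F) (qs : Fin (ar f) → A.Q) (q : A.Q),
    (qs, q) ∈ A.trans f → (fun i => toFun (qs i), toFun q) ∈ B.trans f

/-- `A ⊑ B` : there exists a homomorphism from `A` to `B`. -/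
def ALe {F : Type} {ar : F → ℕ} (A B : Automaton F ar) : Prop := Nonempty (AHom A B)

def EGraph.Le {F : Type} {ar : F → ℕ} (G H : EGraph F ar) : Prop :=
  ALe G.toAutomaton H.toAutomaton

/-- Isomorphism of E-graphs: mutually inverse homomorphisms. -/
def EGraph.Iso {F : Type} {ar : F → ℕ} (G H : EGraph F ar) : Prop :=
  ∃ (h : AHom G.toAutomaton H.toAutomaton) (h' : AHom H.toAutomaton G.toAutomaton),
    (∀ q, h'.toFun (h.toFun q) = q) ∧ (∀ q, h.toFun (h'.toFun q) = q)

/-- The partial congruence relation `≈_G` induced by an E-graph: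
two ground terms are related iff some state accepts both. -/
def EGraph.eqv {F : Type} {ar : F → ℕ} (G : EGraph F ar) (t1 t2 : GTm F ar) : Prop :=
  ∃ q : G.Q, G.toAutomaton.AcceptsG t1 q ∧ G.toAutomaton.AcceptsG t2 q

/-- A finite E-graph: finitely many states and transitions. -/
def EGraph.IsFinite {F : Type} {ar : F → ℕ} (G : EGraph F ar) : Prop :=
  Finite G.Q ∧ ∀ f : F, (G.trans f).Finite

/-! ## Partial congruence relations -/

/-- A partial congruence relation (PCR) on ground terms: a symmetric, transitive,
congruent and reachable binary relation. -/
structure IsPCR {F : Type} {ar : F → ℕ} (E : GTm F ar → GTm F ar → Prop) : Prop where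
  symm : ∀ {t1 t2 : GTm F ar}, E t1 t2 → E t2 t1
  trans : ∀ {t1 t2 t3 : GTm F ar}, E t1 t2 → E t2 t3 → E t1 t3
  congruent : ∀ (f : F) (s t : Fin (ar f) → GTm F ar),
    (∀ i, E (s i) (t i)) → E (.node f s) (.node f s) → E (.node f s) (.node f t)
  reachable : ∀ (f : F) (s : Fin (ar f) → GTm F ar),
    E (.node f s) (.node f s) → ∀ i, E (s i) (s i)

/-- The join of two PCRs: the smallest PCR containing both. -/
def joinPCR {F : Type} {ar : F → ℕ} (E1 E2 : GTm F ar → GTm F ar → Prop)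
    (a b : GTm F ar) : Prop :=
  ∀ E : GTm F ar → GTm F ar → Prop, IsPCR E →
    (∀ x y, E1 x y → E x y) → (∀ x y, E2 x y → E x y) → E a b

/-! ## Term rewriting systems -/

/-- A term rewriting system: a finite set of rules `lhs → rhs` between patterns
(terms with variables drawn from `ℕ`), with `Var(rhs) ⊆ Var(lhs)`. -/
structure TRS (F : Type) (ar : F → ℕ) where
  rules : Set (Tm F ar ℕ × Tm F ar ℕ)
  finite : rules.Finite
  var_cond : ∀ r ∈ rules, Tm.vars r.2 ⊆ Tm.vars r.1

/-- The ground rewrite relation `→_R` determined by a TRS. -/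
inductive RWStep {F : Type} {ar : F → ℕ} (R : TRS F ar) : GTm F ar → GTm F ar → Prop where
  | rule {l r : Tm F ar ℕ} (h : (l, r) ∈ R.rules) (σ : ℕ → GTm F ar) :
      RWStep R (l.subst σ) (r.subst σ)
  | congr {f : F} {ts : Fin (ar f) → GTm F ar} {i : Fin (ar f)} {u : GTm F ar} :
      RWStep R (ts i) u → RWStep R (.node f ts) (.node f (Function.update ts i u))

/-- `≈_R` : the reflexive-symmetric-transitive closure of `→_R`. -/
def TRSEqv {F : Type} {ar : F → ℕ} (R : TRS F ar) : GTm F ar → GTm F ar → Prop :=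
  Relation.ReflTransGen fun a b => RWStep R a b ∨ RWStep R b a

/-! ## E-matching, insertion and congruence closure -/

/-- An e-match of a rule in an E-graph: a substitution `σ` into E-classes and a root
E-class `c` with `lhs[σ] →*_G c`. -/
structure EMatch {F : Type} {ar : F → ℕ} (R : TRS F ar) (G : EGraph F ar) : Type where
  lhs : Tm F ar ℕ
  rhs : Tm F ar ℕ
  mem : (lhs, rhs) ∈ R.rules
  sub : ℕ → G.Q
  root : G.Q
  acc : Accepts G.toAutomaton (Tm.map sub lhs) root

/-- Fresh states of the flattenings added by the match/apply operator: one state per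
(match, subterm of the instantiated right-hand side). -/
def MExtra {F : Type} {ar : F → ℕ} (R : TRS F ar) (G : EGraph F ar) : Type :=
  { p : EMatch R G × Tm F ar G.Q // Subterm p.2 (Tm.map p.1.sub p.1.rhs) }

open Classical in
/-- The state of the flattening `FL(rhs[σ] →* c)` associated to a subterm `u` of `rhs[σ]`:
states at the leaves are kept, the root is mapped to `c = root`, and all other subterms
get a fresh state. -/
noncomputable def stateOf {F : Type} {ar : F → ℕ} (R : TRS F ar) (G : EGraph F ar)
    (m : EMatch R G) :
    (u : Tm F ar G.Q) → Subterm u (Tm.map m.sub m.rhs) → G.Q ⊕ MExtra R G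
  | .var q, _ => Sum.inl q
  | .node f ts, h =>
      if Tm.node f ts = Tm.map m.sub m.rhs then Sum.inl m.root
      else Sum.inr ⟨(m, Tm.node f ts), h⟩

/-- The match/apply operator `T_R`: the (possibly non-deterministic) tree automaton
obtained from `G` by inserting the flattening `FL(rhs[σ] →* c)` for every e-match. -/
noncomputable def TRaut {F : Type} {ar : F → ℕ} (R : TRS F ar) (G : EGraph F ar) :
    Automaton F ar where
  Q := G.Q ⊕ MExtra R G
  trans f := { p |
    (∃ (qs : Fin (ar f) → G.Q) (q : G.Q), (qs, q) ∈ G.trans f ∧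
      p = (fun i => Sum.inl (qs i), Sum.inl q)) ∨
    (∃ (m : EMatch R G) (ts : Fin (ar f) → Tm F ar G.Q)
        (h : Subterm (.node f ts) (Tm.map m.sub m.rhs)),
      p = (fun i => stateOf R G m (ts i) (Subterm.child i h),
           stateOf R G m (.node f ts) h)) }

/-- `G` is the congruence closure (rebuilding) of the automaton `A`: the ⊑-least E-graph
above `A`. -/
def IsCC {F : Type} {ar : F → ℕ} (A : Automaton F ar) (G : EGraph F ar) : Prop :=
  ALe A G.toAutomaton ∧ ∀ H : EGraph F ar, ALe A H.toAutomaton → EGraph.Le G H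

/-- `H` is (up to isomorphism) the result of the immediate consequence operator
`ICO_R = CC ∘ T_R` applied to `G`. -/
def IsICO {F : Type} {ar : F → ℕ} (R : TRS F ar) (G H : EGraph F ar) : Prop :=
  IsCC (TRaut R G) H

/-- `S` is the sequence of iterates `S i = ICO_R^(i)(G)`. -/
def IterSeq {F : Type} {ar : F → ℕ} (R : TRS F ar) (G : EGraph F ar)
    (S : ℕ → EGraph F ar) : Prop :=
  S 0 = G ∧ ∀ i, IsICO R (S i) (S (i + 1))

/-- `H` is a least upper bound of the sequence `S` of E-graphs. -/
def IsLUBseq {F : Type} {ar : F → ℕ} (S : ℕ → EGraph F ar) (H : EGraph F ar) : Prop :=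
  (∀ i, (S i).Le H) ∧ ∀ H' : EGraph F ar, (∀ i, (S i).Le H') → H.Le H'

/-- `H` is a least upper bound of the family `Gs` of E-graphs. -/
def IsLUBfam {F : Type} {ar : F → ℕ} {I : Type} (Gs : I → EGraph F ar)
    (H : EGraph F ar) : Prop :=
  (∀ i, (Gs i).Le H) ∧ ∀ H' : EGraph F ar, (∀ i, (Gs i).Le H') → H.Le H'

/-- `H = EqSat(R, G) = ⊔_{i ≥ 0} ICO_R^(i)(G)`. -/
def IsEqSat {F : Type} {ar : F → ℕ} (R : TRS F ar) (G H : EGraph F ar) : Prop :=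
  ∃ S : ℕ → EGraph F ar, IterSeq R G S ∧ IsLUBseq S H

/-- `H` is a model of the TRS `R`. -/
def ModelTRS {F : Type} {ar : F → ℕ} (R : TRS F ar) (H : EGraph F ar) : Prop :=
  ∀ r ∈ R.rules, ∀ (σ : ℕ → H.Q) (c : H.Q),
    Accepts H.toAutomaton (Tm.map σ r.1) c → Accepts H.toAutomaton (Tm.map σ r.2) c

/-- `H` is a model of the pair `(R, G)`. -/
def IsModelOf {F : Type} {ar : F → ℕ} (R : TRS F ar) (G H : EGraph F ar) : Prop :=
  G.Le H ∧ ModelTRS R H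

/-- `H` is a universal model of the pair `(R, G)`. -/
def IsUniversalModel {F : Type} {ar : F → ℕ} (R : TRS F ar) (G H : EGraph F ar) : Prop :=
  IsModelOf R G H ∧ ∀ H' : EGraph F ar, IsModelOf R G H' → H.Le H'

/-- `G` is (up to isomorphism) the flattening `FL(t →* c)` of a ground term `t`:
the ⊑-least E-graph representing `t`. -/
def IsTermEG {F : Type} {ar : F → ℕ} (t : GTm F ar) (G : EGraph F ar) : Prop :=
  (∃ c, G.toAutomaton.AcceptsG t c) ∧
  ∀ H : EGraph F ar, (∃ c, H.toAutomaton.AcceptsG t c) → G.Le H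

/-- Equality saturation terminates on `(R, G)`: the sequence of iterates
`ICO_R^(i)(G)` is eventually constant up to isomorphism. -/
def EqSatTerminates {F : Type} {ar : F → ℕ} (R : TRS F ar) (G : EGraph F ar) : Prop :=
  ∃ S : ℕ → EGraph F ar, IterSeq R G S ∧ ∃ n, ∀ m, n ≤ m → (S m).Iso (S n)

/-! ## Homomorphisms and acceptance -/

section CongruenceClosure

variable {F : Type} {ar : F → ℕ}

theorem AHom.acceptsG {A B : Automaton F ar} (h : AHom A B) (t : GTm F ar) :
    ∀ {q : A.Q}, A.AcceptsG t q → B.AcceptsG t (h.toFun q) := by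
  induction t with
  | var e => exact e.elim
  | node f ts ih =>
    intro q hq
    cases hq with
    | node hqs hmem => exact Accepts.node (fun i => ih i (hqs i)) (h.map_trans _ _ _ hmem)

/-- In an E-graph, the target of a transition is determined by its sources. -/
theorem EGraph.trans_functional (G : EGraph F ar) {f : F} {qs : Fin (ar f) → G.Q} {q q' : G.Q}
    (h : (qs, q) ∈ G.trans f) (h' : (qs, q') ∈ G.trans f) : q = q' := by
  choose t ht using fun i => G.reach (qs i)
  exact G.det (.node f t) q q' (Accepts.node ht h) (Accepts.node ht h')

theorem Automaton.deterministic_of_trans_functional {A : Automaton F ar}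
    (hA : ∀ (f : F) (qs : Fin (ar f) → A.Q) (q q' : A.Q),
      (qs, q) ∈ A.trans f → (qs, q') ∈ A.trans f → q = q') :
    A.Deterministic := by
  intro t
  induction t with
  | var e => exact e.elim
  | node f ts ih =>
    intro q q' hq hq'
    cases hq with
    | node hqs hmem =>
      cases hq' with
      | node hqs' hmem' =>
        obtain rfl := funext fun i => ih i _ _ (hqs i) (hqs' i)
        exact hA _ _ _ _ hmem hmem'

/-- Every endomorphism of an E-graph is the identity. -/
theorem EGraph.endo_apply {G : EGraph F ar} (h : AHom G.toAutomaton G.toAutomaton) (q : G.Q) :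
    h.toFun q = q := by
  obtain ⟨t, ht⟩ := G.reach q
  exact G.det t _ _ (h.acceptsG t ht) ht

/-- Composition of homomorphisms. -/
def AHom.comp {A B C : Automaton F ar} (k : AHom B C) (h : AHom A B) : AHom A C where
  toFun q := k.toFun (h.toFun q)
  map_trans f qs q hq := k.map_trans f _ _ (h.map_trans f qs q hq)

theorem EGraph.iso_of_le_of_le {G H : EGraph F ar} (hGH : G.Le H) (hHG : H.Le G) : G.Iso H := by
  obtain ⟨h⟩ := hGH
  obtain ⟨k⟩ := hHG
  exact ⟨h, k, EGraph.endo_apply (k.comp h), EGraph.endo_apply (h.comp k)⟩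

/-! ## The congruence closure as a quotient -/

/-- An equivalence relation on states that identifies the targets of any two transitions with
the same symbol and equivalent sources. -/
def Automaton.IsCongruence (A : Automaton F ar) (s : Setoid A.Q) : Prop :=
  ∀ (f : F) (qs qs' : Fin (ar f) → A.Q) (q q' : A.Q),
    (qs, q) ∈ A.trans f → (qs', q') ∈ A.trans f → (∀ i, s (qs i) (qs' i)) → s q q'

/-- The least congruence on the states of an automaton. -/
def Automaton.leastCongruence (A : Automaton F ar) : Setoid A.Q :=
  sInf {s | A.IsCongruence s}

theorem Automaton.isCongruence_leastCongruence (A : Automaton F ar) :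
    A.IsCongruence A.leastCongruence :=
  fun f qs qs' q q' h h' hqs s hs => hs f qs qs' q q' h h' fun i => hqs i s hs

/-- The quotient of an automaton by an equivalence relation on its states. -/
def Automaton.quotient (A : Automaton F ar) (s : Setoid A.Q) : Automaton F ar where
  Q := Quotient s
  trans f := {p | ∃ (qs : Fin (ar f) → A.Q) (q : A.Q), (qs, q) ∈ A.trans f ∧
    p = (fun i => Quotient.mk s (qs i), Quotient.mk s q)}

/-- The projection of an automaton onto its quotient. -/
def Automaton.quotientMk (A : Automaton F ar) (s : Setoid A.Q) : AHom A (A.quotient s) where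
  toFun := Quotient.mk s
  map_trans _ qs q hq := ⟨qs, q, hq, rfl⟩

theorem Automaton.IsCongruence.deterministic_quotient {A : Automaton F ar} {s : Setoid A.Q}
    (hs : A.IsCongruence s) : (A.quotient s).Deterministic := by
  refine Automaton.deterministic_of_trans_functional ?_
  rintro f _ _ _ ⟨as, a, ha, he⟩ ⟨bs, b, hb, he'⟩
  obtain ⟨rfl, rfl⟩ := Prod.mk.inj he
  obtain ⟨hsrc, rfl⟩ := Prod.mk.inj he'
  exact Quotient.sound (hs f as bs a b ha hb fun i => Quotient.exact (congrFun hsrc i))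

theorem Automaton.ReachableA.quotient {A : Automaton F ar} (hA : A.ReachableA)
    (s : Setoid A.Q) : (A.quotient s).ReachableA := by
  intro c
  obtain ⟨q, rfl⟩ := Quotient.exists_rep c
  obtain ⟨t, ht⟩ := hA q
  exact ⟨t, (A.quotientMk s).acceptsG t ht⟩

/-- A homomorphism whose kernel contains `s` factors through the quotient by `s`. -/
def AHom.quotientLift {A B : Automaton F ar} (h : AHom A B) (s : Setoid A.Q)
    (hs : s ≤ Setoid.ker h.toFun) : AHom (A.quotient s) B where
  toFun := Quotient.lift h.toFun fun _ _ hab => hs hab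
  map_trans := by
    rintro f _ _ ⟨as, a, ha, he⟩
    obtain ⟨rfl, rfl⟩ := Prod.mk.inj he
    exact h.map_trans f as a ha

theorem AHom.isCongruence_ker {A : Automaton F ar} {H : EGraph F ar}
    (h : AHom A H.toAutomaton) : A.IsCongruence (Setoid.ker h.toFun) := by
  intro f qs qs' q q' hq hq' hqs
  have hsrc : (fun i => h.toFun (qs i)) = fun i => h.toFun (qs' i) := funext hqs
  have hmem := h.map_trans f qs q hq
  rw [hsrc] at hmem
  exact H.trans_functional hmem (h.map_trans f qs' q' hq')

/-- The congruence closure of a reachable automaton: its quotient by the least congruence. -/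
def Automaton.congruenceClosure (A : Automaton F ar) (hA : A.ReachableA) : EGraph F ar where
  toAutomaton := A.quotient A.leastCongruence
  det := A.isCongruence_leastCongruence.deterministic_quotient
  reach := hA.quotient _

theorem Automaton.isCC_congruenceClosure (A : Automaton F ar) (hA : A.ReachableA) :
    IsCC A (A.congruenceClosure hA) :=
  ⟨⟨A.quotientMk _⟩, fun _ ⟨h⟩ => ⟨h.quotientLift _ (sInf_le h.isCongruence_ker)⟩⟩

end CongruenceClosure

/-- For every reachable tree automaton `A`, the congruence closure `CC(A)` exists and is
unique up to isomorphism: there is an E-graph `G` with `A ⊑ G` such that `G ⊑ G'` for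
every E-graph `G'` with `A ⊑ G'`. -/
theorem congruence_closure_exists_unique {F : Type} {ar : F → ℕ} [Finite F]
    (A : Automaton F ar) (hA : A.ReachableA) :
    (∃ G : EGraph F ar, IsCC A G) ∧
    (∀ G G' : EGraph F ar, IsCC A G → IsCC A G' → G.Iso G') := by
  exact ⟨⟨_, A.isCC_congruenceClosure hA⟩,
    fun G G' hG hG' => EGraph.iso_of_le_of_le (hG.2 G' hG'.1) (hG'.2 G hG.1)⟩
end

section
/- For any term rewriting system R, the immediate consequence operator ICO_R = CC ∘ T_R on E-graphs is inflationary (G ⊑ ICO_R(G) for every E-graph G) and monotone (G ⊑ G' implies ICO_R(G) ⊑ ICO_R(G')). -/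
set_option autoImplicit false

namespace Tm

variable {F : Type} {ar : F → ℕ} {U V W : Type}

theorem map_map (σ : U → V) (τ : V → W) (t : Tm F ar U) :
    (t.map σ).map τ = t.map (τ ∘ σ) := by
  induction t with
  | var v => rfl
  | node f ts ih => simp only [map, ih]

end Tm

theorem Subterm.map {F : Type} {ar : F → ℕ} {V W : Type} (σ : V → W) {u t : Tm F ar V}
    (h : Subterm u t) : Subterm (u.map σ) (t.map σ) := by
  induction h with
  | refl => exact .refl _
  | node i _ ih => exact .node i ih

theorem Accepts.map {F : Type} {ar : F → ℕ} {A B : Automaton F ar} (h : AHom A B)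
    {t : Tm F ar A.Q} {q : A.Q} (ht : Accepts A t q) :
    Accepts B (t.map h.toFun) (h.toFun q) := by
  induction ht with
  | var q => exact .var _
  | node _ htrans ih => exact .node ih (h.map_trans _ _ _ htrans)

theorem ALe.trans {F : Type} {ar : F → ℕ} {A B C : Automaton F ar}
    (hAB : ALe A B) (hBC : ALe B C) : ALe A C := by
  obtain ⟨h⟩ := hAB
  obtain ⟨k⟩ := hBC
  exact ⟨⟨k.toFun ∘ h.toFun, fun f _ _ hq => k.map_trans f _ _ (h.map_trans f _ _ hq)⟩⟩

section MatchApply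

variable {F : Type} {ar : F → ℕ} {R : TRS F ar} {G G' : EGraph F ar}

/-- The image of an e-match under a homomorphism of E-graphs. -/
def EMatch.map (g : AHom G.toAutomaton G'.toAutomaton) (m : EMatch R G) : EMatch R G' where
  lhs := m.lhs
  rhs := m.rhs
  mem := m.mem
  sub := g.toFun ∘ m.sub
  root := g.toFun m.root
  acc := Tm.map_map m.sub g.toFun m.lhs ▸ m.acc.map g

theorem EMatch.subterm_map (g : AHom G.toAutomaton G'.toAutomaton) (m : EMatch R G)
    {u : Tm F ar G.Q} (h : Subterm u (Tm.map m.sub m.rhs)) :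
    Subterm (u.map g.toFun) (Tm.map (m.map g).sub (m.map g).rhs) :=
  Tm.map_map m.sub g.toFun m.rhs ▸ h.map g.toFun

/-- The action of a homomorphism of E-graphs on the states of the match/apply operator. -/
noncomputable def TRaut.mapState (g : AHom G.toAutomaton G'.toAutomaton) :
    G.Q ⊕ MExtra R G → G'.Q ⊕ MExtra R G'
  | .inl q => .inl (g.toFun q)
  | .inr x => stateOf R G' (x.1.1.map g) (x.1.2.map g.toFun) (x.1.1.subterm_map g x.2)

theorem TRaut.mapState_stateOf (g : AHom G.toAutomaton G'.toAutomaton) (m : EMatch R G)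
    (u : Tm F ar G.Q) (h : Subterm u (Tm.map m.sub m.rhs)) :
    TRaut.mapState g (stateOf R G m u h) =
      stateOf R G' (m.map g) (u.map g.toFun) (m.subterm_map g h) := by
  cases u with
  | var q => rfl
  | node f ts =>
    by_cases hroot : Tm.node f ts = Tm.map m.sub m.rhs
    · have hroot' : (Tm.node f fun i => (ts i).map g.toFun) =
          Tm.map (m.map g).sub (m.map g).rhs :=
        (congrArg (Tm.map g.toFun) hroot).trans (Tm.map_map _ _ _)
      simp only [stateOf, Tm.map, if_pos hroot, if_pos hroot']
      rfl
    · rw [stateOf, if_neg hroot]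
      rfl

/-- The match/apply operator is monotone. -/
theorem TRaut.mono (hG : G.Le G') : ALe (TRaut R G) (TRaut R G') := by
  obtain ⟨g⟩ := hG
  refine ⟨⟨TRaut.mapState g, ?_⟩⟩
  rintro f qs q (⟨ps, p, hp, heq⟩ | ⟨m, ts, h, heq⟩)
  · obtain ⟨rfl, rfl⟩ := Prod.mk.inj heq
    exact .inl ⟨_, _, g.map_trans f ps p hp, rfl⟩
  · obtain ⟨rfl, rfl⟩ := Prod.mk.inj heq
    refine .inr ⟨m.map g, fun i => (ts i).map g.toFun, m.subterm_map g h, ?_⟩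
    simp only [TRaut.mapState_stateOf]
    rfl

/-- The match/apply operator is inflationary. -/
theorem TRaut.le_self (R : TRS F ar) (G : EGraph F ar) : ALe G.toAutomaton (TRaut R G) :=
  ⟨⟨Sum.inl, fun _ qs q hq => .inl ⟨qs, q, hq, rfl⟩⟩⟩

end MatchApply

/-- The immediate consequence operator `ICO_R = CC ∘ T_R` is inflationary
(`G ⊑ ICO_R(G)`) and monotone (`G ⊑ G'` implies `ICO_R(G) ⊑ ICO_R(G')`). -/
theorem ico_inflationary_monotone {F : Type} {ar : F → ℕ} [Finite F] (R : TRS F ar) :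
    (∀ G H : EGraph F ar, IsICO R G H → G.Le H) ∧
    (∀ G G' H H' : EGraph F ar, G.Le G' → IsICO R G H → IsICO R G' H' → H.Le H') := by
  refine ⟨fun G H hH => (TRaut.le_self R G).trans hH.1, fun G G' H H' hG hH hH' => ?_⟩
  exact hH.2 H' ((TRaut.mono hG).trans hH'.1)
end
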